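/- Let μ be a finite measure on a measurable space X, and let k : X × X → ℝ be a bounded measurable symmetric kernel with 0 < a ≤ k(x,y) ≤ b for all x, y in the support of μ, defining the operator (Kφ)(x) = ∫ k(x,y) φ(y) dμ(y). Let U be a bounded measurable function, bounded away from zero, solving the Sinkhorn problem U(x)·(KU)(x) = 1 μ-a.e. Define the accelerated symmetric Sinkhorn iteration from any bounded measurable U^{(0)} bounded away from zero by U^{(n)}_a = 1/(K U^{(n)}), U^{(n)}_b = 1/(K U^{(n)}_a), U^{(n+1)} = √(U^{(n)}_a · U^{(n)}_b). Let θ = tanh( (1/4) sup_{x,y ∈ supp μ} d_Λ(k(x,·), k(y,·)) ), where d_Λ(φ,ψ) = sup log(φ/ψ) − inf log(φ/ψ) is the Hilbert projective metric; then θ < 1 and for all n ≥ 0, ‖log U^{(n)} − log U‖_{L^∞(μ)} ≤ 2 (θ(1+θ)/2)^n ‖log U^{(0)} − log U‖_{L^∞(μ)}. -/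

import Mathlib

open MeasureTheory

noncomputable section
namespace ASSA

variable {X : Type*} [MeasurableSpace X]

/-- The kernel operator `(Kφ)(x) = ∫ k(x,y) φ(y) dμ(y)`. -/
def Kop (μ : Measure X) (k : X → X → ℝ) (f : X → ℝ) (x : X) : ℝ :=
  ∫ y, k x y * f y ∂μ

/-- One Sinkhorn half-step `U ↦ 1/(KU)`. -/
def sinkStep (μ : Measure X) (k : X → X → ℝ) (U : X → ℝ) : X → ℝ :=
  fun x => (Kop μ k U x)⁻¹

/-- One step of the accelerated symmetric Sinkhorn algorithm:
`U_a = 1/(KU)`, `U_b = 1/(KU_a)`, then the geometric mean `√(U_a U_b)`. -/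
def assaStep (μ : Measure X) (k : X → X → ℝ) (U : X → ℝ) : X → ℝ :=
  fun x => Real.sqrt (sinkStep μ k U x * sinkStep μ k (sinkStep μ k U) x)

/-- The iterates `U^{(n)}` of the accelerated symmetric Sinkhorn algorithm. -/
def assaIter (μ : Measure X) (k : X → X → ℝ) (U0 : X → ℝ) : ℕ → X → ℝ
  | 0 => U0
  | n + 1 => assaStep μ k (assaIter μ k U0 n)

/-- The Hilbert projective (pseudo-)metric
`d_Λ(φ,ψ) = sup log(φ/ψ) − inf log(φ/ψ)`. -/
def hilbDist [Nonempty X] (φ ψ : X → ℝ) : ℝ :=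
  (⨆ x, Real.log (φ x / ψ x)) - (⨅ x, Real.log (φ x / ψ x))

/-- The worst-case contraction rate `θ` of standard Sinkhorn iteration:
`θ = tanh((1/4) sup_{x,y} d_Λ(k(x,·), k(y,·)))`. -/
def theta [Nonempty X] (k : X → X → ℝ) : ℝ :=
  Real.tanh ((1 / 4) * ⨆ x, ⨆ y, hilbDist (fun z => k x z) (fun z => k y z))

/-- The scalar inequality behind the Birkhoff contraction rate. -/
theorem log_cosh_add_sub_log_cosh_sub_le {s t : ℝ} (hs : 0 ≤ s) (ht : 0 ≤ t) :
    Real.log (Real.cosh (s + t)) - Real.log (Real.cosh (s - t)) ≤ 2 * s * Real.tanh t := by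
  have hd : ∀ x : ℝ, HasDerivAt (fun x : ℝ => 2 * x * Real.tanh t -
      (Real.log (Real.cosh (x + t)) - Real.log (Real.cosh (x - t))))
      (2 * 1 * Real.tanh t - (Real.sinh (x + t) * 1 / Real.cosh (x + t)
        - Real.sinh (x - t) * 1 / Real.cosh (x - t))) x := by
    intro x
    have h1 := (((hasDerivAt_id x).add_const t).cosh).log (Real.cosh_pos (x + t)).ne'
    have h2 := (((hasDerivAt_id x).sub_const t).cosh).log (Real.cosh_pos (x - t)).ne'
    exact (((hasDerivAt_id x).const_mul 2).mul_const _).sub (h1.sub h2)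
  have hm : Monotone (fun x : ℝ => 2 * x * Real.tanh t -
      (Real.log (Real.cosh (x + t)) - Real.log (Real.cosh (x - t)))) := by
    refine monotone_of_deriv_nonneg (fun x => (hd x).differentiableAt) fun x => ?_
    rw [(hd x).deriv, Real.tanh_eq_sinh_div_cosh]
    have hx := Real.cosh_pos (x + t)
    have hx' := Real.cosh_pos (x - t)
    have hc := Real.cosh_pos t
    have e : 2 * 1 * (Real.sinh t / Real.cosh t) - (Real.sinh (x + t) * 1 / Real.cosh (x + t)
        - Real.sinh (x - t) * 1 / Real.cosh (x - t)) =
        2 * Real.sinh t * Real.sinh x ^ 2 /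
          (Real.cosh t * Real.cosh (x + t) * Real.cosh (x - t)) := by
      field_simp
      rw [Real.cosh_add, Real.cosh_sub, Real.sinh_add, Real.sinh_sub]
      linear_combination 2 * Real.sinh t * Real.sinh x ^ 2 * Real.cosh_sq t
    rw [e]
    have := Real.sinh_nonneg_iff.2 ht
    positivity
  have := hm hs
  simp at this
  linarith

/-- Of all `2 × 2` configurations with cross ratio at most `C ^ 2`, the symmetric one maximizes
the ratio of means. -/
theorem mul_mul_le_of_mul_le_sq_mul {a a' b b' R C : ℝ} (ha : 0 ≤ a) (ha' : 0 ≤ a')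
    (hb : 0 ≤ b) (hb' : 0 ≤ b') (hR : 1 ≤ R) (hC : 1 ≤ C) (h : a * b' ≤ C ^ 2 * (a' * b)) :
    (R ^ 2 * a + a') * (b + b') * (C + R) ^ 2 ≤
      (1 + R * C) ^ 2 * ((a + a') * (R ^ 2 * b + b')) := by
  obtain ⟨p, hp, rfl⟩ : ∃ p, 0 ≤ p ∧ a = p ^ 2 := ⟨√a, by positivity, (Real.sq_sqrt ha).symm⟩
  obtain ⟨p', hp', rfl⟩ : ∃ p, 0 ≤ p ∧ a' = p ^ 2 := ⟨√a', by positivity, (Real.sq_sqrt ha').symm⟩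
  obtain ⟨q, hq, rfl⟩ : ∃ p, 0 ≤ p ∧ b = p ^ 2 := ⟨√b, by positivity, (Real.sq_sqrt hb).symm⟩
  obtain ⟨q', hq', rfl⟩ : ∃ p, 0 ≤ p ∧ b' = p ^ 2 := ⟨√b', by positivity, (Real.sq_sqrt hb').symm⟩
  have h' : p * q' ≤ C * (p' * q) := by
    refine (sq_le_sq₀ (by positivity) (by positivity)).1 ?_
    linarith [h]
  have h1 : 0 ≤ (C * (p' * q) - p * q') * (p' * q + C * (p * q')) :=
    mul_nonneg (sub_nonneg.2 h') (by positivity)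
  have hR2 : 0 ≤ R ^ 2 - 1 := by nlinarith
  have hC2 : 0 ≤ C ^ 2 - 1 := by nlinarith
  have h2 := mul_nonneg hR2 (mul_nonneg hC2 (sq_nonneg (R * (p * q) - p' * q')))
  have h3 := mul_nonneg hR2 (mul_nonneg (by positivity : 0 ≤ 2 * R) h1)
  have h4 := mul_nonneg hR2 (mul_nonneg (by positivity : 0 ≤ R ^ 2 + 1) (sub_nonneg.2 h))
  linarith [h2, h3, h4]

theorem log_div_sub_log_div_le {a a' b b' D o : ℝ} (ha : 0 ≤ a) (ha' : 0 ≤ a')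
    (hb : 0 ≤ b) (hb' : 0 ≤ b') (hA : 0 < a + a') (hB : 0 < b + b') (hD : 0 ≤ D) (ho : 0 ≤ o)
    (h : a * b' ≤ Real.exp D * (a' * b)) :
    Real.log ((Real.exp o * a + a') / (a + a')) - Real.log ((Real.exp o * b + b') / (b + b'))
      ≤ Real.tanh (1 / 4 * D) * o := by
  have hone : 1 ≤ Real.exp o := Real.one_le_exp ho
  have hA' : 0 < Real.exp o * a + a' := by nlinarith
  have hB' : 0 < Real.exp o * b + b' := by nlinarith
  have eR : Real.exp (o / 2) ^ 2 = Real.exp o := by rw [← Real.exp_nat_mul]; congr 1; push_cast; ring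
  have eC : Real.exp (D / 2) ^ 2 = Real.exp D := by rw [← Real.exp_nat_mul]; congr 1; push_cast; ring
  have key := mul_mul_le_of_mul_le_sq_mul ha ha' hb hb'
    (Real.one_le_exp (by positivity : 0 ≤ o / 2)) (Real.one_le_exp (by positivity : 0 ≤ D / 2))
    (by rwa [eC])
  rw [eR] at key
  have hch : (1 + Real.exp (o / 2) * Real.exp (D / 2)) / (Real.exp (D / 2) + Real.exp (o / 2)) =
      Real.cosh (o / 4 + 1 / 4 * D) / Real.cosh (o / 4 - 1 / 4 * D) := by
    have e1 : Real.exp (o / 2) = Real.exp (o / 4) ^ 2 := by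
      rw [← Real.exp_nat_mul]; congr 1; push_cast; ring
    have e2 : Real.exp (D / 2) = Real.exp (1 / 4 * D) ^ 2 := by
      rw [← Real.exp_nat_mul]; congr 1; push_cast; ring
    rw [Real.cosh_eq, Real.cosh_eq, e1, e2, neg_add, neg_sub, Real.exp_add, Real.exp_add,
      Real.exp_sub, Real.exp_sub, Real.exp_neg, Real.exp_neg]
    have := Real.exp_pos (o / 4)
    have := Real.exp_pos (1 / 4 * D)
    field_simp
    ring
  have hle : (Real.exp o * a + a') / (a + a') / ((Real.exp o * b + b') / (b + b')) ≤
      (Real.cosh (o / 4 + 1 / 4 * D) / Real.cosh (o / 4 - 1 / 4 * D)) ^ 2 := by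
    rw [← hch, div_pow, div_div_div_eq, div_le_div_iff₀ (by positivity) (by positivity)]
    exact key
  rw [← Real.log_div (by positivity) (by positivity)]
  have := Real.log_le_log (by positivity) hle
  rw [Real.log_pow, Real.log_div (Real.cosh_pos _).ne' (Real.cosh_pos _).ne'] at this
  have h2 := log_cosh_add_sub_log_cosh_sub_le (s := o / 4) (t := 1 / 4 * D)
    (by positivity) (by positivity)
  push_cast at this
  linarith

/-- A measurable function that is bounded and bounded away from zero. -/
def PosBdd (f : X → ℝ) : Prop :=
  Measurable f ∧ ∃ l L : ℝ, 0 < l ∧ ∀ x, l ≤ f x ∧ f x ≤ L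

/-- The `μ`-essential oscillation of `log (g / f)` is at most `o`. -/
def LogOscLe (μ : Measure X) (f g : X → ℝ) (o : ℝ) : Prop :=
  ∃ m : ℝ, ∀ᵐ x ∂μ, Real.exp m * f x ≤ g x ∧ g x ≤ Real.exp (m + o) * f x

/-- A measurable kernel with values in `[a, b]`, where `0 < a`. -/
structure BddKernel (k : X → X → ℝ) (a b : ℝ) : Prop where
  meas : Measurable (Function.uncurry k)
  pos : 0 < a
  lb : ∀ x y, a ≤ k x y
  ub : ∀ x y, k x y ≤ b

section

variable {μ : Measure X} {k : X → X → ℝ} {a b : ℝ}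

namespace PosBdd

variable {f g : X → ℝ}

theorem pos (hf : PosBdd f) (x : X) : 0 < f x := by
  obtain ⟨-, l, L, hl, h⟩ := hf
  exact hl.trans_le (h x).1

theorem integrable [IsFiniteMeasure μ] (hf : PosBdd f) : Integrable f μ := by
  have hp := hf.pos
  obtain ⟨hm, l, L, hl, h⟩ := hf
  exact Integrable.of_bound hm.aestronglyMeasurable L
    (.of_forall fun x => by rw [Real.norm_of_nonneg (hp x).le]; exact (h x).2)

theorem integral_pos [IsFiniteMeasure μ] [NeZero μ] (hf : PosBdd f) : 0 < ∫ x, f x ∂μ := by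
  rw [integral_pos_iff_support_of_nonneg (fun x => (hf.pos x).le) hf.integrable]
  have : Function.support f = Set.univ := by
    ext x; simp [(hf.pos x).ne']
  rw [this]
  simp [NeZero.ne μ]

theorem mul (hf : PosBdd f) (hg : PosBdd g) : PosBdd fun x => f x * g x := by
  have hp := hf.pos
  have hq := hg.pos
  obtain ⟨hm, l, L, hl, h⟩ := hf
  obtain ⟨hm', l', L', hl', h'⟩ := hg
  refine ⟨hm.mul hm', l * l', L * L', by positivity, fun x => ⟨?_, ?_⟩⟩
  · exact mul_le_mul (h x).1 (h' x).1 hl'.le (hp x).le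
  · exact mul_le_mul (h x).2 (h' x).2 (hq x).le ((hp x).le.trans (h x).2)

theorem inv (hf : PosBdd f) : PosBdd fun x => (f x)⁻¹ := by
  have hp := hf.pos
  obtain ⟨hm, l, L, hl, h⟩ := hf
  refine ⟨hm.inv, (max L 1)⁻¹, l⁻¹, by positivity, fun x => ⟨?_, ?_⟩⟩
  · exact inv_anti₀ (hp x) ((h x).2.trans (le_max_left _ _))
  · exact inv_anti₀ hl (h x).1

theorem sqrt (hf : PosBdd f) : PosBdd fun x => √(f x) := by
  obtain ⟨hm, l, L, hl, h⟩ := hf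
  exact ⟨hm.sqrt, √l, √L, by positivity,
    fun x => ⟨Real.sqrt_le_sqrt (h x).1, Real.sqrt_le_sqrt (h x).2⟩⟩

theorem log_bound (hf : PosBdd f) : ∃ C, ∀ x, |Real.log (f x)| ≤ C := by
  have hp := hf.pos
  obtain ⟨hm, l, L, hl, h⟩ := hf
  refine ⟨max |Real.log l| |Real.log L|, fun x => ?_⟩
  exact abs_le_max_abs_abs (Real.log_le_log hl (h x).1) (Real.log_le_log (hp x) (h x).2)

end PosBdd

namespace BddKernel

theorem kernel_pos (hk : BddKernel k a b) (x y : X) : 0 < k x y := hk.pos.trans_le (hk.lb x y)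

theorem posBdd_apply (hk : BddKernel k a b) (x : X) : PosBdd (k x) :=
  ⟨hk.meas.of_uncurry_left, a, b, hk.pos, fun y => ⟨hk.lb x y, hk.ub x y⟩⟩

theorem kop_posBdd [IsFiniteMeasure μ] [NeZero μ] (hk : BddKernel k a b) {f : X → ℝ}
    (hf : PosBdd f) : PosBdd (Kop μ k f) := by
  have hi := hf.integral_pos (μ := μ)
  refine ⟨?_, a * ∫ y, f y ∂μ, b * ∫ y, f y ∂μ, mul_pos hk.pos hi, fun x => ⟨?_, ?_⟩⟩
  · have : Measurable (Function.uncurry fun x y => k x y * f y) :=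
      hk.meas.mul (hf.1.comp measurable_snd)
    exact this.stronglyMeasurable.integral_prod_right.measurable
  · rw [← integral_const_mul]
    exact integral_mono (hf.integrable.const_mul _) ((hk.posBdd_apply x).mul hf).integrable
      fun y => mul_le_mul_of_nonneg_right (hk.lb x y) (hf.pos y).le
  · rw [← integral_const_mul]
    exact integral_mono ((hk.posBdd_apply x).mul hf).integrable (hf.integrable.const_mul _)
      fun y => mul_le_mul_of_nonneg_right (hk.ub x y) (hf.pos y).le

theorem sinkStep_posBdd [IsFiniteMeasure μ] [NeZero μ] (hk : BddKernel k a b) {f : X → ℝ}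
    (hf : PosBdd f) : PosBdd (sinkStep μ k f) :=
  (hk.kop_posBdd hf).inv

theorem assaStep_posBdd [IsFiniteMeasure μ] [NeZero μ] (hk : BddKernel k a b) {f : X → ℝ}
    (hf : PosBdd f) : PosBdd (assaStep μ k f) :=
  ((hk.sinkStep_posBdd hf).mul (hk.sinkStep_posBdd (hk.sinkStep_posBdd hf))).sqrt

theorem abs_log_div_le (hk : BddKernel k a b) (x y z : X) :
    |Real.log (k x z / k y z)| ≤ Real.log (b / a) := by
  have hb : 0 < b := hk.pos.trans_le ((hk.lb x z).trans (hk.ub x z))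
  have ha := hk.pos
  rw [Real.log_div (hk.kernel_pos x z).ne' (hk.kernel_pos y z).ne', Real.log_div hb.ne' ha.ne',
    abs_le]
  have h1 := Real.log_le_log ha (hk.lb x z)
  have h2 := Real.log_le_log ha (hk.lb y z)
  have h3 := Real.log_le_log (hk.kernel_pos x z) (hk.ub x z)
  have h4 := Real.log_le_log (hk.kernel_pos y z) (hk.ub y z)
  constructor <;> linarith

theorem log_div_sub_log_div_le_hilbDist [Nonempty X] (hk : BddKernel k a b) (x y z z' : X) :
    Real.log (k x z / k y z) - Real.log (k x z' / k y z') ≤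
      hilbDist (fun z => k x z) (fun z => k y z) := by
  refine sub_le_sub (le_ciSup (f := fun z => Real.log (k x z / k y z)) ?_ z)
    (ciInf_le (f := fun z => Real.log (k x z / k y z)) ?_ z')
  · exact ⟨_, Set.forall_mem_range.2 fun w => (abs_le.1 (hk.abs_log_div_le x y w)).2⟩
  · exact ⟨_, Set.forall_mem_range.2 fun w => (abs_le.1 (hk.abs_log_div_le x y w)).1⟩

theorem hilbDist_le [Nonempty X] (hk : BddKernel k a b) (x y : X) :
    hilbDist (fun z => k x z) (fun z => k y z) ≤ 2 * Real.log (b / a) := by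
  have h1 : (⨆ z, Real.log (k x z / k y z)) ≤ Real.log (b / a) :=
    ciSup_le fun w => (abs_le.1 (hk.abs_log_div_le x y w)).2
  have h2 : -Real.log (b / a) ≤ ⨅ z, Real.log (k x z / k y z) :=
    le_ciInf fun w => (abs_le.1 (hk.abs_log_div_le x y w)).1
  unfold hilbDist
  linarith

theorem hilbDist_le_iSup [Nonempty X] (hk : BddKernel k a b) (x y : X) :
    hilbDist (fun z => k x z) (fun z => k y z) ≤
      ⨆ x, ⨆ y, hilbDist (fun z => k x z) (fun z => k y z) :=
  (le_ciSup (f := fun y => hilbDist (fun z => k x z) (fun z => k y z))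
    ⟨_, Set.forall_mem_range.2 fun w => hk.hilbDist_le x w⟩ y).trans
  (le_ciSup (f := fun x => ⨆ y, hilbDist (fun z => k x z) (fun z => k y z))
    ⟨_, Set.forall_mem_range.2 fun w => ciSup_le fun w' => hk.hilbDist_le w w'⟩ x)

theorem iSup_hilbDist_nonneg [Nonempty X] (hk : BddKernel k a b) :
    0 ≤ ⨆ x, ⨆ y, hilbDist (fun z => k x z) (fun z => k y z) := by
  obtain ⟨x⟩ := ‹Nonempty X›
  have := (hk.log_div_sub_log_div_le_hilbDist x x x x).trans (hk.hilbDist_le_iSup x x)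
  rwa [sub_self] at this

theorem theta_nonneg [Nonempty X] (hk : BddKernel k a b) : 0 ≤ theta k := by
  have := hk.iSup_hilbDist_nonneg
  rw [theta, Real.tanh_eq_sinh_div_cosh]
  exact div_nonneg (Real.sinh_nonneg_iff.2 (by positivity)) (Real.cosh_pos _).le

theorem mul_le_exp_mul [Nonempty X] (hk : BddKernel k a b) (x y z z' : X) :
    k x z * k y z' ≤ Real.exp (⨆ x, ⨆ y, hilbDist (fun z => k x z) (fun z => k y z)) *
      (k y z * k x z') := by
  have h := (hk.log_div_sub_log_div_le_hilbDist x y z z').trans (hk.hilbDist_le_iSup x y)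
  have := hk.kernel_pos x z
  have := hk.kernel_pos y z
  have := hk.kernel_pos x z'
  have := hk.kernel_pos y z'
  rw [← Real.log_div (by positivity) (by positivity), Real.log_le_iff_le_exp (by positivity),
    div_div_div_eq, div_le_iff₀ (by positivity)] at h
  exact h

end BddKernel

/-- The Birkhoff contraction inequality for a pair of rows `p`, `q` of a positive kernel. -/
theorem log_integral_div_sub_le [IsFiniteMeasure μ] [NeZero μ] {p q f g : X → ℝ} {D m o : ℝ}
    (hp : PosBdd p) (hq : PosBdd q) (hf : PosBdd f) (hg : PosBdd g)
    (hD : 0 ≤ D) (ho : 0 ≤ o)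
    (hpq : ∀ z z', p z * q z' ≤ Real.exp D * (q z * p z'))
    (hfg : ∀ᵐ x ∂μ, Real.exp m * f x ≤ g x ∧ g x ≤ Real.exp (m + o) * f x) :
    Real.log ((∫ z, p z * g z ∂μ) / ∫ z, p z * f z ∂μ) -
      Real.log ((∫ z, q z * g z ∂μ) / ∫ z, q z * f z ∂μ) ≤ Real.tanh (1 / 4 * D) * o := by
  rcases ho.eq_or_lt with rfl | ho'
  · have key : ∀ r : X → ℝ, PosBdd r →
        (∫ z, r z * g z ∂μ) / ∫ z, r z * f z ∂μ = Real.exp m := by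
      intro r hr
      rw [div_eq_iff (hr.mul hf).integral_pos.ne', ← integral_const_mul]
      refine integral_congr_ae ?_
      filter_upwards [hfg] with z hz
      rw [add_zero] at hz
      rw [le_antisymm hz.2 hz.1]
      ring
    rw [key p hp, key q hq]
    simp
  have hexp : Real.exp m < Real.exp (m + o) := Real.exp_lt_exp.2 (by linarith)
  have hδ : 0 < Real.exp (m + o) - Real.exp m := sub_pos.2 hexp
  set u : X → ℝ := fun z => g z - Real.exp m * f z with hu
  set v : X → ℝ := fun z => Real.exp (m + o) * f z - g z with hv
  have hu0 : ∀ᵐ z ∂μ, 0 ≤ u z := hfg.mono fun z hz => sub_nonneg.2 hz.1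
  have hv0 : ∀ᵐ z ∂μ, 0 ≤ v z := hfg.mono fun z hz => sub_nonneg.2 hz.2
  have iu : ∀ r : X → ℝ, PosBdd r → Integrable (fun z => r z * u z) μ := fun r hr => by
    refine ((hr.mul hg).integrable.sub ((hr.mul hf).integrable.const_mul (Real.exp m))).congr
      (.of_forall fun z => ?_)
    simp only [hu, Pi.sub_apply]
    ring
  have iv : ∀ r : X → ℝ, PosBdd r → Integrable (fun z => r z * v z) μ := fun r hr => by
    refine (((hr.mul hf).integrable.const_mul (Real.exp (m + o))).sub (hr.mul hg).integrable).congr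
      (.of_forall fun z => ?_)
    simp only [hv, Pi.sub_apply]
    ring
  have nn : ∀ r w : X → ℝ, PosBdd r → (∀ᵐ z ∂μ, 0 ≤ w z) → 0 ≤ ∫ z, r z * w z ∂μ :=
    fun r w hr hw => integral_nonneg_of_ae (hw.mono fun z hz => mul_nonneg (hr.pos z).le hz)
  have sf : ∀ r : X → ℝ, PosBdd r → (∫ z, r z * u z ∂μ) + ∫ z, r z * v z ∂μ =
      (Real.exp (m + o) - Real.exp m) * ∫ z, r z * f z ∂μ := fun r hr => by
    rw [← integral_add (iu r hr) (iv r hr), ← integral_const_mul]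
    congr 1 with z
    simp only [hu, hv]
    ring
  have sg : ∀ r : X → ℝ, PosBdd r →
      Real.exp m * (Real.exp o * (∫ z, r z * u z ∂μ) + ∫ z, r z * v z ∂μ) =
      (Real.exp (m + o) - Real.exp m) * ∫ z, r z * g z ∂μ := fun r hr => by
    rw [← integral_const_mul, ← integral_add ((iu r hr).const_mul _) (iv r hr),
      ← integral_const_mul, ← integral_const_mul]
    congr 1 with z
    simp only [hu, hv, Real.exp_add]
    ring
  have pos : ∀ r : X → ℝ, PosBdd r → 0 < (∫ z, r z * u z ∂μ) + ∫ z, r z * v z ∂μ := fun r hr => by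
    rw [sf r hr]
    exact mul_pos hδ (hr.mul hf).integral_pos
  have ratio : ∀ r : X → ℝ, PosBdd r →
      Real.log ((∫ z, r z * g z ∂μ) / ∫ z, r z * f z ∂μ) = m +
        Real.log ((Real.exp o * (∫ z, r z * u z ∂μ) + ∫ z, r z * v z ∂μ) /
          ((∫ z, r z * u z ∂μ) + ∫ z, r z * v z ∂μ)) := fun r hr => by
    have hgp := (hr.mul hg).integral_pos (μ := μ)
    have hsum : 0 < Real.exp o * (∫ z, r z * u z ∂μ) + ∫ z, r z * v z ∂μ := by
      have : 0 < Real.exp m * (Real.exp o * (∫ z, r z * u z ∂μ) + ∫ z, r z * v z ∂μ) := by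
        rw [sg r hr]; positivity
      exact pos_of_mul_pos_right this (Real.exp_pos m).le
    rw [← mul_div_mul_left _ _ hδ.ne', ← sg r hr, ← sf r hr, mul_div_assoc,
      Real.log_mul (Real.exp_pos m).ne' (div_pos hsum (pos r hr)).ne', Real.log_exp]
  have cross : (∫ z, p z * u z ∂μ) * (∫ z, q z * v z ∂μ) ≤
      Real.exp D * ((∫ z, p z * v z ∂μ) * ∫ z, q z * u z ∂μ) := by
    have inner : ∀ z', (∫ z, p z * u z ∂μ) * q z' ≤ Real.exp D * (∫ z, q z * u z ∂μ) * p z' := by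
      intro z'
      rw [← integral_mul_const, ← integral_const_mul, ← integral_mul_const]
      refine integral_mono_ae ((iu p hp).mul_const _) (((iu q hq).const_mul _).mul_const _) ?_
      filter_upwards [hu0] with z hz
      have := mul_le_mul_of_nonneg_right (hpq z z') hz
      linarith
    calc (∫ z, p z * u z ∂μ) * (∫ z, q z * v z ∂μ)
        = ∫ z', (∫ z, p z * u z ∂μ) * (q z' * v z') ∂μ := (integral_const_mul _ _).symm
      _ ≤ ∫ z', (Real.exp D * (∫ z, q z * u z ∂μ)) * (p z' * v z') ∂μ := by
          refine integral_mono_ae ((iv q hq).const_mul _) ((iv p hp).const_mul _) ?_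
          filter_upwards [hv0] with z' hz'
          have := mul_le_mul_of_nonneg_right (inner z') hz'
          linarith
      _ = _ := by rw [integral_const_mul]; ring
  rw [ratio p hp, ratio q hq, add_sub_add_left_eq_sub]
  exact log_div_sub_log_div_le (nn p u hp hu0) (nn p v hp hv0) (nn q u hq hu0) (nn q v hq hv0)
    (pos p hp) (pos q hq) hD ho cross

/-- A Sinkhorn half-step contracts the oscillation relative to a fixed point by `θ`. -/
theorem LogOscLe.sinkStep [Nonempty X] [IsFiniteMeasure μ] [NeZero μ] (hk : BddKernel k a b)
    {U g : X → ℝ} {o : ℝ} (hUp : PosBdd U) (hU : ∀ᵐ x ∂μ, U x * Kop μ k U x = 1)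
    (hg : PosBdd g) (ho : 0 ≤ o) (h : LogOscLe μ U g o) :
    LogOscLe μ U (sinkStep μ k g) (theta k * o) := by
  obtain ⟨m, hm⟩ := h
  have hKU := hk.kop_posBdd (μ := μ) hUp
  have hKg := hk.kop_posBdd (μ := μ) hg
  set L : X → ℝ := fun x => Real.log (Kop μ k g x / Kop μ k U x) with hL
  have hpair : ∀ x y, L x - L y ≤ theta k * o := fun x y =>
    log_integral_div_sub_le (hk.posBdd_apply x) (hk.posBdd_apply y) hUp hg
      hk.iSup_hilbDist_nonneg ho (hk.mul_le_exp_mul x y) hm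
  obtain ⟨x₀⟩ := ‹Nonempty X›
  have hbdd : BddAbove (Set.range L) :=
    ⟨theta k * o + L x₀, Set.forall_mem_range.2 fun x => by linarith [hpair x x₀]⟩
  have hsup : ∀ x, (⨆ y, L y) ≤ theta k * o + L x := fun x =>
    have : Nonempty X := ⟨x⟩
    ciSup_le fun y => by linarith [hpair y x]
  refine ⟨-⨆ x, L x, ?_⟩
  filter_upwards [hU] with x hx
  have hs : ASSA.sinkStep μ k g x = Real.exp (-L x) * U x := by
    have h1 := hKU.pos x
    have h2 := hKg.pos x
    rw [Real.exp_neg, hL, Real.exp_log (div_pos h2 h1), ASSA.sinkStep, eq_inv_of_mul_eq_one_left hx]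
    field_simp
  rw [hs]
  constructor
  · exact mul_le_mul_of_nonneg_right
      (Real.exp_le_exp.2 (neg_le_neg (le_ciSup hbdd x))) (hUp.pos x).le
  · exact mul_le_mul_of_nonneg_right (Real.exp_le_exp.2 (by linarith [hsup x])) (hUp.pos x).le

theorem LogOscLe.sqrt_mul {f g g' : X → ℝ} {o o' : ℝ} (hf : PosBdd f) (hg : PosBdd g)
    (hg' : PosBdd g') (h : LogOscLe μ f g o) (h' : LogOscLe μ f g' o') :
    LogOscLe μ f (fun x => √(g x * g' x)) ((o + o') / 2) := by
  obtain ⟨m, hm⟩ := h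
  obtain ⟨m', hm'⟩ := h'
  have key : ∀ s t c : ℝ, 0 < c → Real.exp ((s + t) / 2) * c =
      √((Real.exp s * c) * (Real.exp t * c)) := by
    intro s t c hc
    rw [eq_comm, Real.sqrt_eq_iff_mul_self_eq_of_pos (by positivity)]
    have : Real.exp ((s + t) / 2) * Real.exp ((s + t) / 2) = Real.exp s * Real.exp t := by
      rw [← Real.exp_add, ← Real.exp_add]; congr 1; ring
    linear_combination c ^ 2 * this
  refine ⟨(m + m') / 2, ?_⟩
  filter_upwards [hm, hm'] with x hx hx'
  have hfx := hf.pos x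
  have hgx := (hg.pos x).le
  have hgx' := (hg'.pos x).le
  have e : (m + m') / 2 + (o + o') / 2 = ((m + o) + (m' + o')) / 2 := by ring
  rw [e, key _ _ _ hfx, key _ _ _ hfx]
  exact ⟨Real.sqrt_le_sqrt (mul_le_mul hx.1 hx'.1 (by positivity) hgx),
    Real.sqrt_le_sqrt (mul_le_mul hx.2 hx'.2 hgx' (hgx.trans hx.2))⟩

theorem LogOscLe.assaStep [Nonempty X] [IsFiniteMeasure μ] [NeZero μ] (hk : BddKernel k a b)
    {U g : X → ℝ} {o : ℝ} (hUp : PosBdd U) (hU : ∀ᵐ x ∂μ, U x * Kop μ k U x = 1)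
    (hg : PosBdd g) (ho : 0 ≤ o) (h : LogOscLe μ U g o) :
    LogOscLe μ U (assaStep μ k g) (theta k * (1 + theta k) / 2 * o) := by
  have h1 := h.sinkStep hk hUp hU hg ho
  have hp1 := hk.sinkStep_posBdd (μ := μ) hg
  have h2 := h1.sinkStep hk hUp hU hp1 (mul_nonneg hk.theta_nonneg ho)
  have := LogOscLe.sqrt_mul hUp hp1 (hk.sinkStep_posBdd hp1) h1 h2
  rwa [show (theta k * o + theta k * (theta k * o)) / 2 = theta k * (1 + theta k) / 2 * o by
    ring] at this

theorem BddKernel.integral_mul_kop_comm [IsFiniteMeasure μ] (hk : BddKernel k a b)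
    (hksymm : ∀ x y, k x y = k y x) {f g : X → ℝ} (hf : PosBdd f) (hg : PosBdd g) :
    ∫ x, f x * Kop μ k g x ∂μ = ∫ x, g x * Kop μ k f x ∂μ := by
  have hfst : PosBdd fun p : X × X => f p.1 :=
    ⟨hf.1.comp measurable_fst, hf.2.imp fun _ => Exists.imp fun _ h => ⟨h.1, fun p => h.2 p.1⟩⟩
  have hsnd : PosBdd fun p : X × X => g p.2 :=
    ⟨hg.1.comp measurable_snd, hg.2.imp fun _ => Exists.imp fun _ h => ⟨h.1, fun p => h.2 p.2⟩⟩
  have hker : PosBdd (Function.uncurry k) :=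
    ⟨hk.meas, a, b, hk.pos, fun p => ⟨hk.lb p.1 p.2, hk.ub p.1 p.2⟩⟩
  have hint : Integrable (Function.uncurry fun x y => f x * (k x y * g y)) (μ.prod μ) :=
    (hfst.mul (hker.mul hsnd)).integrable
  have := integral_integral_swap hint
  simp only [integral_const_mul] at this
  simp only [Kop]
  rw [this]
  congr 1 with y
  rw [← integral_const_mul]
  congr 1 with x
  rw [hksymm x y]
  ring

/-- The logarithm of `assaStep g / U` cannot be bounded away from zero from one side. -/
theorem log_bounds_assaStep [IsFiniteMeasure μ] [NeZero μ] (hk : BddKernel k a b)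
    (hksymm : ∀ x y, k x y = k y x)
    {U g : X → ℝ} (hUp : PosBdd U) (hU : ∀ᵐ x ∂μ, U x * Kop μ k U x = 1) (hg : PosBdd g) {m M : ℝ}
    (h : ∀ᵐ x ∂μ, Real.exp m * U x ≤ assaStep μ k g x ∧ assaStep μ k g x ≤ Real.exp M * U x) :
    m ≤ 0 ∧ 0 ≤ M := by
  set s := sinkStep μ k g with hs
  have hsp : PosBdd s := hk.sinkStep_posBdd hg
  have hKs := hk.kop_posBdd (μ := μ) hsp
  have hKU := hk.kop_posBdd (μ := μ) hUp
  have hI := (hUp.mul hKs).integral_pos (μ := μ)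
  have hsymm := hk.integral_mul_kop_comm (μ := μ) hksymm hUp hsp
  have hpt : ∀ᵐ x ∂μ, Real.exp m ^ 2 * (U x * Kop μ k s x) ≤ s x * Kop μ k U x ∧
      s x * Kop μ k U x ≤ Real.exp M ^ 2 * (U x * Kop μ k s x) := by
    filter_upwards [h, hU] with x hx hUx
    have hux := hUp.pos x
    have hKsx := hKs.pos x
    have hsx := hsp.pos x
    have hsq : assaStep μ k g x ^ 2 = s x * (Kop μ k s x)⁻¹ :=
      Real.sq_sqrt (mul_nonneg hsx.le (inv_nonneg.2 hKsx.le))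
    have h0 : 0 ≤ assaStep μ k g x := Real.sqrt_nonneg _
    have h1 := pow_le_pow_left₀ (by positivity) hx.1 2
    have h2 := pow_le_pow_left₀ h0 hx.2 2
    rw [hsq, mul_pow, ← div_eq_mul_inv] at h1 h2
    rw [le_div_iff₀ hKsx] at h1
    rw [div_le_iff₀ hKsx] at h2
    have eK : Kop μ k U x = (U x)⁻¹ := eq_inv_of_mul_eq_one_right hUx
    rw [eK, ← div_eq_mul_inv, le_div_iff₀ hux, div_le_iff₀ hux]
    constructor <;> linarith
  have i1 := (hUp.mul hKs).integrable (μ := μ)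
  have i2 := (hsp.mul hKU).integrable (μ := μ)
  have l1 := integral_mono_ae (i1.const_mul _) i2 (hpt.mono fun x hx => hx.1)
  have l2 := integral_mono_ae i2 (i1.const_mul _) (hpt.mono fun x hx => hx.2)
  rw [integral_const_mul, ← hsymm] at l1 l2
  constructor
  · by_contra! hm
    exact absurd (lt_mul_of_one_lt_left hI
      (one_lt_pow₀ (Real.one_lt_exp_iff.2 hm) two_ne_zero)) l1.not_gt
  · by_contra! hM
    exact absurd (mul_lt_of_lt_one_left hI
      (pow_lt_one₀ (Real.exp_pos M).le (Real.exp_lt_one_iff.2 hM) two_ne_zero)) l2.not_gt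

theorem ae_norm_log_assaStep_sub_le [Nonempty X] [IsFiniteMeasure μ] [NeZero μ]
    (hk : BddKernel k a b) (hksymm : ∀ x y, k x y = k y x)
    {U g : X → ℝ} {o : ℝ} (hUp : PosBdd U) (hU : ∀ᵐ x ∂μ, U x * Kop μ k U x = 1) (hg : PosBdd g)
    (h : LogOscLe μ U (assaStep μ k g) o) :
    ∀ᵐ x ∂μ, ‖Real.log (assaStep μ k g x) - Real.log (U x)‖ ≤ o := by
  obtain ⟨m, hm⟩ := h
  obtain ⟨h1, h2⟩ := log_bounds_assaStep hk hksymm hUp hU hg hm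
  have hp := hk.assaStep_posBdd (μ := μ) hg
  filter_upwards [hm] with x hx
  have hux := hUp.pos x
  have l1 := Real.log_le_log (by positivity) hx.1
  have l2 := Real.log_le_log (hp.pos x) hx.2
  rw [Real.log_mul (Real.exp_pos _).ne' hux.ne', Real.log_exp] at l1 l2
  rw [Real.norm_eq_abs, abs_le]
  constructor <;> linarith

theorem LogOscLe.of_ae_norm_log_sub_le {f g : X → ℝ} {N : ℝ} (hf : PosBdd f) (hg : PosBdd g)
    (h : ∀ᵐ x ∂μ, ‖Real.log (g x) - Real.log (f x)‖ ≤ N) : LogOscLe μ f g (2 * N) := by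
  refine ⟨-N, ?_⟩
  filter_upwards [h] with x hx
  rw [Real.norm_eq_abs, abs_le] at hx
  have key : ∀ c, Real.exp c * f x = Real.exp (c + Real.log (f x)) := fun c => by
    rw [Real.exp_add, Real.exp_log (hf.pos x)]
  rw [key, key, ← Real.le_log_iff_exp_le (hg.pos x), ← Real.log_le_iff_le_exp (hg.pos x)]
  constructor <;> linarith [hx.1, hx.2]

theorem assaIter_posBdd [IsFiniteMeasure μ] [NeZero μ] (hk : BddKernel k a b) {U0 : X → ℝ}
    (hU0 : PosBdd U0) (n : ℕ) : PosBdd (assaIter μ k U0 n) := by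
  induction n with
  | zero => exact hU0
  | succ n ih => exact hk.assaStep_posBdd ih

theorem LogOscLe.assaIter [Nonempty X] [IsFiniteMeasure μ] [NeZero μ] (hk : BddKernel k a b)
    {U U0 : X → ℝ} {o : ℝ} (hUp : PosBdd U) (hU : ∀ᵐ x ∂μ, U x * Kop μ k U x = 1)
    (hU0 : PosBdd U0) (ho : 0 ≤ o) (h : LogOscLe μ U U0 o) (n : ℕ) :
    LogOscLe μ U (assaIter μ k U0 n) ((theta k * (1 + theta k) / 2) ^ n * o) := by
  have hθ := hk.theta_nonneg
  induction n with
  | zero => simpa [ASSA.assaIter] using h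
  | succ n ih =>
    have := ih.assaStep hk hUp hU (assaIter_posBdd hk hU0 n) (by positivity)
    rwa [← mul_assoc, ← pow_succ'] at this

end

/-- **Global convergence of the accelerated symmetric Sinkhorn algorithm**
(Theorem `t:ASSA`(a)). With `θ` the worst-case Sinkhorn contraction rate, `θ < 1`
and `‖log U^{(n)} − log U‖_{L^∞(μ)} ≤ 2 (θ(1+θ)/2)^n ‖log U^{(0)} − log U‖_{L^∞(μ)}`. -/
theorem assa_global_convergence
    {X : Type*} [MeasurableSpace X] [Nonempty X]
    (μ : Measure X) [IsFiniteMeasure μ]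
    (k : X → X → ℝ) (a b : ℝ) (ha : 0 < a)
    (hkmeas : Measurable (Function.uncurry k))
    (hksymm : ∀ x y, k x y = k y x)
    (hklb : ∀ x y, a ≤ k x y) (hkub : ∀ x y, k x y ≤ b)
    (U : X → ℝ) (hUmeas : Measurable U)
    (mU MU : ℝ) (hmU : 0 < mU) (hUbd : ∀ x, mU ≤ U x ∧ U x ≤ MU)
    (hU : ∀ᵐ x ∂μ, U x * Kop μ k U x = 1)
    (U0 : X → ℝ) (hU0meas : Measurable U0)
    (m0 M0 : ℝ) (hm0 : 0 < m0) (hU0bd : ∀ x, m0 ≤ U0 x ∧ U0 x ≤ M0) :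
    theta k < 1 ∧
    ∀ n : ℕ,
      eLpNorm (fun x => Real.log (assaIter μ k U0 n x) - Real.log (U x)) ⊤ μ
        ≤ ENNReal.ofReal (2 * (theta k * (1 + theta k) / 2) ^ n) *
            eLpNorm (fun x => Real.log (U0 x) - Real.log (U x)) ⊤ μ := by
  have hk : BddKernel k a b := ⟨hkmeas, ha, hklb, hkub⟩
  refine ⟨Real.tanh_lt_one _, fun n => ?_⟩
  rcases eq_or_ne μ 0 with rfl | hμ
  · simp
  have : NeZero μ := ⟨hμ⟩
  have hUp : PosBdd U := ⟨hUmeas, mU, MU, hmU, hUbd⟩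
  have hU0 : PosBdd U0 := ⟨hU0meas, m0, M0, hm0, hU0bd⟩
  have hθ := hk.theta_nonneg
  simp only [eLpNorm_exponent_top]
  set N := eLpNormEssSup (fun x => Real.log (U0 x) - Real.log (U x)) μ with hN
  have hfin : N ≠ ⊤ := by
    obtain ⟨C, hC⟩ := hUp.log_bound
    obtain ⟨C0, hC0⟩ := hU0.log_bound
    exact (eLpNormEssSup_lt_top_of_ae_bound (C := C0 + C)
      (.of_forall fun x => (norm_sub_le _ _).trans (add_le_add (hC0 x) (hC x)))).ne
  cases n with
  | zero =>
    simp only [pow_zero, mul_one, assaIter]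
    exact le_mul_of_one_le_left zero_le (by simp)
  | succ n =>
    have hbound : ∀ᵐ x ∂μ, ‖Real.log (U0 x) - Real.log (U x)‖ ≤ N.toReal := by
      filter_upwards [ae_le_eLpNormEssSup (μ := μ)
        (f := fun x => Real.log (U0 x) - Real.log (U x))] with x hx
      rw [← toReal_enorm]
      exact ENNReal.toReal_mono hfin hx
    have hosc := (LogOscLe.of_ae_norm_log_sub_le hUp hU0 hbound).assaIter hk hUp hU hU0
      (by positivity) (n + 1)
    refine (eLpNormEssSup_le_of_ae_bound
      (ae_norm_log_assaStep_sub_le hk hksymm hUp hU (assaIter_posBdd hk hU0 n) hosc)).trans ?_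
    conv_rhs => rw [← ENNReal.ofReal_toReal hfin]
    rw [← ENNReal.ofReal_mul (by positivity)]
    exact ENNReal.ofReal_le_ofReal (by linarith)

end ASSA
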